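/- Let α be a split type-B composition of n and let π ∈ H_α. Then π has no type-B (α,231)-split pattern if and only if for all 1 ≤ i < k ≤ n the following implications hold: (a) if [i] ∈ Cov(π), then [j] ∈ Inv(π) for all 1 ≤ j < i whose α-region is strictly smaller than that of i; (b) if (i,k) ∈ Cov(π), then (i,j) ∈ Inv(π) for all i < j < k whose α-region lies strictly between those of i and k; (c) if (−k,i) ∈ Cov(π), then [i] ∈ Inv(π), (−j,i) ∈ Inv(π) for all 1 ≤ j < k with j ≠ i whose α-region is strictly smaller than that of k, and (−k,j) ∈ Inv(π) for all 1 ≤ j < i whose α-region is strictly smaller than that of i. -/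

import Mathlib

namespace TypeB

/-- A sign-symmetric permutation of degree `n`: a bijection of `ℤ` with
`π(-i) = -π(i)` which fixes every integer of absolute value `> n`.
It restricts to a sign-symmetric permutation of `±[n]`. -/
structure SignedPerm (n : ℕ) where
  perm : Equiv.Perm ℤ
  sign_symm : ∀ i : ℤ, perm (-i) = - perm i
  outside : ∀ i : ℤ, (n : ℤ) < |i| → perm i = i

/-- Symbols for type-B inversions: `neg i` is `[i]`, `pair i j` (with `i < j`)
is `(i,j)`, and `mixed i j` (with `i < j`) is `(−j, i)`. -/
inductive BInv (n : ℕ) : Type where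
  | neg : ℕ → BInv n
  | pair : ℕ → ℕ → BInv n
  | mixed : ℕ → ℕ → BInv n
deriving DecidableEq

/-- `i⁺`: `i+1` if `i ≠ -1`, and `1` for `i = -1`. -/
def iplus (i : ℤ) : ℤ := if i = -1 then 1 else i + 1

/-- The inversion set of a sign-symmetric permutation. -/
def Inv {n : ℕ} (π : SignedPerm n) : Set (BInv n) := fun t =>
  match t with
  | .neg i => 1 ≤ i ∧ i ≤ n ∧ π.perm (i : ℤ) < 0
  | .pair i j => 1 ≤ i ∧ i < j ∧ j ≤ n ∧ π.perm (j : ℤ) < π.perm (i : ℤ)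
  | .mixed i j => 1 ≤ i ∧ i < j ∧ j ≤ n ∧ π.perm (i : ℤ) + π.perm (j : ℤ) < 0

/-- The cover-inversion set of a sign-symmetric permutation. -/
def Cov {n : ℕ} (π : SignedPerm n) : Set (BInv n) := fun t =>
  match t with
  | .neg i => 1 ≤ i ∧ i ≤ n ∧ π.perm (i : ℤ) = -1
  | .pair i j => 1 ≤ i ∧ i < j ∧ j ≤ n ∧ π.perm (i : ℤ) = iplus (π.perm (j : ℤ))
  | .mixed i j => 1 ≤ i ∧ i < j ∧ j ≤ n ∧ π.perm (-(j : ℤ)) = iplus (π.perm (i : ℤ))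

/-- The symbol `(−j, i)` in canonical form (it equals `(−i, j)`). -/
def mixedInv {n : ℕ} (i j : ℕ) : BInv n := .mixed (min i j) (max i j)

/-- A type-B composition of `n`: positive parts summing to `n`,
together with a split/join label. -/
structure BComp (n : ℕ) where
  parts : List ℕ
  pos : ∀ a ∈ parts, 0 < a
  sum_eq : parts.sum = n
  isJoin : Bool

/-- The partial sum `p_i = α₁ + ⋯ + α_i`. -/
def pSum {n : ℕ} (α : BComp n) (i : ℕ) : ℕ := (α.parts.take i).sum

/-- The α-region of `a ∈ [n]`: the unique `i` with `p_{i-1} < a ≤ p_i`. -/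
def region {n : ℕ} (α : BComp n) (a : ℕ) : ℕ :=
  ((Finset.range α.parts.length).filter (fun j => pSum α j < a)).card

/-- The first part `α₁` of a type-B composition. -/
def alpha1 {n : ℕ} (α : BComp n) : ℕ := α.parts.headI

/-- Index of the block of `Part(α)` containing `x ∈ ±[n]`; two elements lie in
a common block of `Part(α)` iff their indices agree. -/
def blockIdx {n : ℕ} (α : BComp n) (x : ℤ) : ℤ :=
  if 0 < x then
    (if α.isJoin = true ∧ region α x.toNat = 1 then 0 else (region α x.toNat : ℤ))
  else
    (if α.isJoin = true ∧ region α (-x).toNat = 1 then 0 else -(region α (-x).toNat : ℤ))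

/-- Membership in `±[n]`. -/
def inPM (n : ℕ) (x : ℤ) : Prop := x ≠ 0 ∧ -(n : ℤ) ≤ x ∧ x ≤ (n : ℤ)

/-- `π ∈ H_α`: `π` is increasing on every block of `Part(α)`. -/
def memH {n : ℕ} (α : BComp n) (π : SignedPerm n) : Prop :=
  ∀ a b : ℤ, inPM n a → inPM n b → a < b → blockIdx α a = blockIdx α b →
    π.perm a < π.perm b

/-- Common part of the type-B `(α,231)`- and `(α,312)`-patterns: indices
`i < j < k` in `±[n]`, in pairwise distinct blocks of `Part(α)`, with `j > 0`
and `π(i) = π(k)⁺`. -/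
def patternCore {n : ℕ} (α : BComp n) (π : SignedPerm n) (i j k : ℤ) : Prop :=
  inPM n i ∧ inPM n j ∧ inPM n k ∧ i < j ∧ j < k ∧ 0 < j ∧
  blockIdx α i ≠ blockIdx α j ∧ blockIdx α j ≠ blockIdx α k ∧
  blockIdx α i ≠ blockIdx α k ∧ π.perm i = iplus (π.perm k)

/-- `π` has a type-B `(α,231)`-split (resp. -join) pattern, according to the
label of `α`. -/
def has231 {n : ℕ} (α : BComp n) (π : SignedPerm n) : Prop :=
  ∃ i j k : ℤ, patternCore α π i j k ∧
    (if α.isJoin = true then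
       (((alpha1 α : ℤ) < j → π.perm i < π.perm j) ∧
        (j ≤ (alpha1 α : ℤ) → π.perm j < π.perm k))
     else π.perm i < π.perm j)

/-- `π` has a type-B `(α,312)`-split (resp. -join) pattern, according to the
label of `α`. -/
def has312 {n : ℕ} (α : BComp n) (π : SignedPerm n) : Prop :=
  ∃ i j k : ℤ, patternCore α π i j k ∧
    (if α.isJoin = true then
       (((alpha1 α : ℤ) < j → π.perm j < π.perm k) ∧
        (j ≤ (alpha1 α : ℤ) → π.perm i < π.perm j))
     else π.perm j < π.perm k)

/-- `π ∈ H_α(231)`. -/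
def mem231 {n : ℕ} (α : BComp n) (π : SignedPerm n) : Prop := memH α π ∧ ¬ has231 α π

/-- `π ∈ H_α(312)`. -/
def mem312 {n : ℕ} (α : BComp n) (π : SignedPerm n) : Prop := memH α π ∧ ¬ has312 α π

/-- The set `H_α`. -/
def Hset {n : ℕ} (α : BComp n) : Set (SignedPerm n) := {π | memH α π}

/-- The carrier of `Tam_B(α)`, namely `H_α(231)`. -/
def Tset {n : ℕ} (α : BComp n) : Set (SignedPerm n) := {π | mem231 α π}

/-- The weak order: inclusion of inversion sets. -/
def wle {n : ℕ} (π σ : SignedPerm n) : Prop := Inv π ⊆ Inv σ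

/-- `m` is the greatest lower bound of `x` and `y` within `P`, w.r.t. the weak order. -/
def isMeetIn {n : ℕ} (P : Set (SignedPerm n)) (x y m : SignedPerm n) : Prop :=
  m ∈ P ∧ wle m x ∧ wle m y ∧ ∀ z ∈ P, wle z x → wle z y → wle z m

/-- `u` is the least upper bound of `x` and `y` within `P`, w.r.t. the weak order. -/
def isJoinIn {n : ℕ} (P : Set (SignedPerm n)) (x y u : SignedPerm n) : Prop :=
  u ∈ P ∧ wle x u ∧ wle y u ∧ ∀ z ∈ P, wle x z → wle y z → wle u z

/-- `d = Π↓(π)`: `d` is the greatest element of `{σ ∈ H_α(231) : Inv σ ⊆ Inv π}`. -/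
def isProjDown {n : ℕ} (α : BComp n) (π d : SignedPerm n) : Prop :=
  mem231 α d ∧ wle d π ∧ ∀ σ, mem231 α σ → wle σ π → wle σ d

/-- `d = Π†(π)`: `d` is the greatest element of `{σ ∈ H_α(312) : Inv σ ⊆ Inv π}`. -/
def isProjDagger {n : ℕ} (α : BComp n) (π d : SignedPerm n) : Prop :=
  mem312 α d ∧ wle d π ∧ ∀ σ, mem312 α σ → wle σ π → wle σ d

/-- The value `ω_{o;α}(a)` for `a ∈ [n]`. -/
def omegaPos {n : ℕ} (α : BComp n) (a : ℕ) : ℤ :=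
  if α.isJoin = true ∧ region α a = 1 then (a : ℤ)
  else -(((pSum α (region α a) : ℤ) + (pSum α (region α a - 1) : ℤ) + 1) - (a : ℤ))

/-- The longest element `ω_{o;α}` of `H_α`, as a function on `ℤ`. -/
def omegaFun {n : ℕ} (α : BComp n) (x : ℤ) : ℤ :=
  if 0 < x ∧ x ≤ (n : ℤ) then omegaPos α x.toNat
  else if 0 < -x ∧ -x ≤ (n : ℤ) then -(omegaPos α (-x).toNat)
  else x

/-- The set of `m` such that there is a strict chain `x₀ < x₁ < ⋯ < x_m` in `P`. -/
def chainLengths {n : ℕ} (P : Set (SignedPerm n)) : Set ℕ :=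
  {m | ∃ f : Fin (m + 1) → SignedPerm n, (∀ i, f i ∈ P) ∧
        ∀ i j : Fin (m + 1), i < j → Inv (f i) ⊂ Inv (f j)}

/-- `x` is join-irreducible in `Tam_B(α)`. -/
def joinIrred {n : ℕ} (α : BComp n) (x : SignedPerm n) : Prop :=
  x ∈ Tset α ∧ ¬ (∀ y ∈ Tset α, wle x y) ∧
  ∀ y z, y ∈ Tset α → z ∈ Tset α → isJoinIn (Tset α) y z x → x = y ∨ x = z

/-- `x` is meet-irreducible in `Tam_B(α)`. -/
def meetIrred {n : ℕ} (α : BComp n) (x : SignedPerm n) : Prop :=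
  x ∈ Tset α ∧ ¬ (∀ y ∈ Tset α, wle y x) ∧
  ∀ y z, y ∈ Tset α → z ∈ Tset α → isMeetIn (Tset α) y z x → x = y ∨ x = z

/-- `x` is left modular in the lattice on `P`: `(r ∨ x) ∧ q = r ∨ (x ∧ q)`
for all `r ≤ q` in `P`. -/
def leftModular {n : ℕ} (P : Set (SignedPerm n)) (x : SignedPerm n) : Prop :=
  ∀ r q, r ∈ P → q ∈ P → wle r q →
    ∀ u v w1 w2, isJoinIn P r x u → isMeetIn P u q v →
      isMeetIn P x q w1 → isJoinIn P r w1 w2 → v = w2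

/-- The simple generator `s_i` as a function on `ℤ`: `s₀` exchanges `1` and `-1`,
and for `i ≥ 1`, `s_i` exchanges `i` with `i+1` and `-i` with `-(i+1)`. -/
def sfun (i : ℕ) (x : ℤ) : ℤ :=
  if i = 0 then (if x = 1 then -1 else if x = -1 then 1 else x)
  else if x = (i : ℤ) then (i : ℤ) + 1
  else if x = (i : ℤ) + 1 then (i : ℤ)
  else if x = -(i : ℤ) then -(i : ℤ) - 1
  else if x = -(i : ℤ) - 1 then -(i : ℤ)
  else x

/-- `i` is one of the partial sums `p₁, …, p_{r−1}` of `α`. -/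
def isPSum {n : ℕ} (α : BComp n) (i : ℕ) : Prop :=
  ∃ j : ℕ, 1 ≤ j ∧ j < α.parts.length ∧ pSum α j = i

/-- `n² − Σᵢ α_i(α_i−1)/2`, minus additionally `(α₁+1)α₁/2` when `α` is join. -/
def lengthFormula {n : ℕ} (α : BComp n) : ℕ :=
  n ^ 2 - (α.parts.map (fun a => a * (a - 1) / 2)).sum -
    (if α.isJoin = true then (alpha1 α + 1) * alpha1 α / 2 else 0)

theorem region_mono {n : ℕ} (α : BComp n) : Monotone (region α) := fun _ _ hab =>
  Finset.card_le_card (Finset.monotone_filter_right _ fun _ _ h => lt_of_lt_of_le h hab)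

theorem lt_of_region_lt {n : ℕ} {α : BComp n} {a b : ℕ} (h : region α a < region α b) :
    a < b :=
  (region_mono α).reflect_lt h

theorem region_pos {n : ℕ} (α : BComp n) {a : ℕ} (ha : 1 ≤ a) (han : a ≤ n) :
    0 < region α a := by
  have hl : 0 < α.parts.length := by
    rw [List.length_pos_iff]
    intro h
    have := α.sum_eq
    rw [h, List.sum_nil] at this
    omega
  exact Finset.card_pos.mpr ⟨0, Finset.mem_filter.mpr
    ⟨by simpa using hl, by simpa [pSum] using Nat.lt_of_succ_le ha⟩⟩

theorem blockIdx_natCast {n : ℕ} {α : BComp n} (hsplit : α.isJoin = false) {a : ℕ}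
    (ha : 1 ≤ a) : blockIdx α (a : ℤ) = region α a := by
  have : 0 < a := ha
  simp [blockIdx, hsplit, this]

theorem blockIdx_neg_natCast {n : ℕ} {α : BComp n} (hsplit : α.isJoin = false) (a : ℕ) :
    blockIdx α (-(a : ℤ)) = -region α a := by
  simp [blockIdx, hsplit]

theorem SignedPerm.perm_ne {n : ℕ} (π : SignedPerm n) {a b : ℤ} (h : a ≠ b) :
    π.perm a ≠ π.perm b :=
  fun e => h (π.perm.injective e)

theorem SignedPerm.perm_ne_zero {n : ℕ} (π : SignedPerm n) {a : ℤ} (h : a ≠ 0) :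
    π.perm a ≠ 0 := by
  have := π.perm_ne h
  have := π.sign_symm 0
  rw [neg_zero] at this
  omega

theorem SignedPerm.perm_add_ne_zero {n : ℕ} (π : SignedPerm n) {a b : ℤ} (h : a + b ≠ 0) :
    π.perm a + π.perm b ≠ 0 := by
  have := π.perm_ne (a := a) (b := -b) (by omega)
  rw [π.sign_symm] at this
  omega

/-- The cover relation is preserved by negation. -/
theorem neg_eq_iplus_comm {x y : ℤ} (hx : x ≠ 0) (hy : y ≠ 0) :
    -x = iplus y ↔ -y = iplus x := by
  unfold iplus
  split_ifs <;> omega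

theorem has231_iff_of_split {n : ℕ} {α : BComp n} (hsplit : α.isJoin = false)
    (π : SignedPerm n) :
    has231 α π ↔ ∃ i j k : ℤ, patternCore α π i j k ∧ π.perm i < π.perm j := by
  simp [has231, hsplit]

/-- A pattern with all three indices positive. -/
theorem patternCore_pos_iff {n : ℕ} {α : BComp n} (hsplit : α.isJoin = false)
    (π : SignedPerm n) {i j k : ℕ} (hi : 1 ≤ i) :
    patternCore α π i j k ↔ BInv.pair i k ∈ Cov π ∧ region α i < region α j ∧
      region α j < region α k := by
  constructor
  · rintro ⟨⟨-, -, -⟩, -, ⟨-, -, hk⟩, hij, hjk, -, h1, h2, -, e⟩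
    rw [blockIdx_natCast hsplit (by omega), blockIdx_natCast hsplit (by omega)] at h1 h2
    have m1 := region_mono α (a := i) (b := j) (by omega)
    have m2 := region_mono α (a := j) (b := k) (by omega)
    exact ⟨⟨hi, by omega, by omega, e⟩, by omega, by omega⟩
  · rintro ⟨⟨-, -, hk, e⟩, h1, h2⟩
    have m1 := lt_of_region_lt h1
    have m2 := lt_of_region_lt h2
    refine ⟨⟨?_, ?_, ?_⟩, ⟨?_, ?_, ?_⟩, ⟨?_, ?_, ?_⟩, ?_, ?_, ?_, ?_, ?_, ?_, e⟩ <;>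
      (try rw [blockIdx_natCast hsplit (by omega), blockIdx_natCast hsplit (by omega)]) <;> omega

/-- A pattern whose first index is negative. -/
theorem patternCore_neg_iff {n : ℕ} {α : BComp n} (hsplit : α.isJoin = false)
    (π : SignedPerm n) {i j k : ℕ} (hi : 1 ≤ i) (hin : i ≤ n) (hj : 1 ≤ j) (hk : k ≤ n) :
    patternCore α π (-(i : ℤ)) j k ↔
      region α j < region α k ∧ -π.perm i = iplus (π.perm k) := by
  rw [← π.sign_symm]
  constructor
  · rintro ⟨-, -, -, -, hjk, -, -, h, -, e⟩
    rw [blockIdx_natCast hsplit (by omega), blockIdx_natCast hsplit (by omega)] at h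
    have m := region_mono α (a := j) (b := k) (by omega)
    exact ⟨by omega, e⟩
  · rintro ⟨h, e⟩
    have m := lt_of_region_lt h
    have p1 := region_pos α hi hin
    refine ⟨⟨?_, ?_, ?_⟩, ⟨?_, ?_, ?_⟩, ⟨?_, ?_, ?_⟩, ?_, ?_, ?_, ?_, ?_, ?_, e⟩ <;>
      (try rw [blockIdx_neg_natCast hsplit]) <;>
      (try rw [blockIdx_natCast hsplit (by omega)]) <;>
      (try rw [blockIdx_natCast hsplit (by omega)]) <;> omega

theorem mixedInv_mem_Inv_iff {n : ℕ} (π : SignedPerm n) {i j : ℕ} (hi : 1 ≤ i) (hj : 1 ≤ j)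
    (hin : i ≤ n) (hjn : j ≤ n) (hij : j ≠ i) :
    mixedInv i j ∈ Inv π ↔ π.perm i + π.perm j < 0 := by
  rcases lt_or_gt_of_ne hij with h | h
  · rw [mixedInv, min_eq_right h.le, max_eq_left h.le, add_comm]
    exact ⟨fun ⟨_, _, _, h'⟩ => h', fun h' => ⟨hj, h, hin, h'⟩⟩
  · rw [mixedInv, min_eq_left h.le, max_eq_right h.le]
    exact ⟨fun ⟨_, _, _, h'⟩ => h', fun h' => ⟨hi, h, hjn, h'⟩⟩

/-- For a split type-B composition `α` and `π ∈ H_α`: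
`π` has no type-B `(α,231)`-split pattern iff the region-refined forcing
conditions (a)–(c) hold. -/
theorem no_split_231_iff_forcing (n : ℕ) (hn : 1 ≤ n) (α : BComp n)
    (hsplit : α.isJoin = false) (π : SignedPerm n) (hπ : memH α π) :
    ¬ has231 α π ↔
      ((∀ i : ℕ, BInv.neg i ∈ Cov π →
          ∀ j : ℕ, 1 ≤ j → j < i → region α j < region α i →
            BInv.neg j ∈ Inv π) ∧
       (∀ i k : ℕ, BInv.pair i k ∈ Cov π →
          ∀ j : ℕ, i < j → j < k →
            region α i < region α j → region α j < region α k →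
            BInv.pair i j ∈ Inv π) ∧
       (∀ i k : ℕ, BInv.mixed i k ∈ Cov π →
          BInv.neg i ∈ Inv π ∧
          (∀ j : ℕ, 1 ≤ j → j < k → j ≠ i → region α j < region α k →
            mixedInv i j ∈ Inv π) ∧
          (∀ j : ℕ, 1 ≤ j → j < i → region α j < region α i →
            BInv.mixed j k ∈ Inv π))) := by
  rw [has231_iff_of_split hsplit]
  constructor
  · intro hno
    have neg_pattern : ∀ i j k : ℕ, 1 ≤ i → i ≤ n → 1 ≤ j → k ≤ n →
        region α j < region α k → -π.perm i = iplus (π.perm k) →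
        π.perm j ≤ -π.perm i := by
      intro i j k hi hin hj hk hr e
      by_contra! hlt
      exact hno ⟨-i, j, k, (patternCore_neg_iff hsplit π hi hin hj hk).2 ⟨hr, e⟩,
        by rwa [π.sign_symm]⟩
    refine ⟨?_, ?_, ?_⟩
    · rintro i ⟨hi, hin, e⟩ j hj hji hr
      have h := neg_pattern i j i hi hin hj hin hr (by simp [e, iplus])
      have h0 := π.perm_ne_zero (a := j) (by omega)
      have h1 := π.perm_add_ne_zero (a := i) (b := j) (by omega)
      exact ⟨hj, by omega, by omega⟩
    · rintro i k hc j hij hjk h1 h2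
      have hi := hc.1
      have hk := hc.2.2.1
      refine ⟨hi, hij, by omega, ?_⟩
      have hne := π.perm_ne (a := j) (b := i) (by omega)
      by_contra! hle
      exact hno ⟨i, j, k, (patternCore_pos_iff hsplit π hi).2 ⟨hc, h1, h2⟩, by omega⟩
    · rintro i k ⟨hi, hik, hk, e⟩
      rw [π.sign_symm] at e
      have hi0 := π.perm_ne_zero (a := i) (by omega)
      have hk0 := π.perm_ne_zero (a := k) (by omega)
      have e' := (neg_eq_iplus_comm hk0 hi0).1 e
      refine ⟨⟨hi, by omega, ?_⟩, ?_, ?_⟩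
      · rcases (region_mono α hik.le).lt_or_eq with hr | hr
        · have := neg_pattern i i k hi (by omega) hi hk hr e'
          omega
        · have hlt : π.perm i < π.perm k := by
            apply hπ
            · exact ⟨by omega, by omega, by omega⟩
            · exact ⟨by omega, by omega, by omega⟩
            · omega
            · rw [blockIdx_natCast hsplit hi, blockIdx_natCast hsplit (by omega), hr]
          unfold iplus at e
          split_ifs at e <;> omega
      · intro j hj hjk hji hr
        rw [mixedInv_mem_Inv_iff π hi hj (by omega) (by omega) hji]
        have := neg_pattern i j k hi (by omega) hj hk hr e'
        have := π.perm_add_ne_zero (a := i) (b := j) (by omega)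
        omega
      · intro j hj hji hr
        have := neg_pattern k j i (by omega) hk hj (by omega) hr e
        have := π.perm_add_ne_zero (a := k) (b := j) (by omega)
        exact ⟨hj, by omega, hk, by omega⟩
  · rintro ⟨ha, hb, hc⟩ ⟨i, j, k, hp, hlt⟩
    obtain ⟨⟨hi0, hin, -⟩, -, ⟨-, -, hkn⟩, -, hjk, hj0, -⟩ := id hp
    lift j to ℕ using hj0.le
    lift k to ℕ using (by omega)
    obtain ⟨i, rfl | rfl⟩ := i.eq_nat_or_neg
    · obtain ⟨hcov, h1, h2⟩ := (patternCore_pos_iff hsplit π (by omega)).1 hp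
      have := (hb i k hcov j (lt_of_region_lt h1) (lt_of_region_lt h2) h1 h2).2.2.2
      omega
    · obtain ⟨hr, e⟩ := (patternCore_neg_iff hsplit π (by omega) (by omega) (by omega)
        (by omega)).1 hp
      rw [π.sign_symm] at hlt
      have hi0 := π.perm_ne_zero (a := i) (by omega)
      have hk0 := π.perm_ne_zero (a := k) (by omega)
      rcases lt_trichotomy i k with hik | rfl | hki
      · obtain ⟨h1, h2, -⟩ := hc i k ⟨by omega, hik, by omega, by
          rwa [π.sign_symm, neg_eq_iplus_comm hk0 hi0]⟩
        by_cases hji : j = i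
        · subst hji
          have := h1.2.2
          omega
        · have := (mixedInv_mem_Inv_iff π (by omega) (by omega) (by omega) (by omega) hji).1
            (h2 j (by omega) (by omega) hji hr)
          omega
      · have e1 : π.perm i = -1 := by
          unfold iplus at e
          split_ifs at e <;> omega
        have := (ha i ⟨by omega, by omega, e1⟩ j (by omega) (by omega) hr).2.2
        omega
      · have := ((hc k i ⟨by omega, hki, by omega, by rwa [π.sign_symm]⟩).2.2 j
          (by omega) (by omega) hr).2.2.2
        omega

end TypeB
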